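/- Let K be an algebraically closed field of characteristic 2 and F = Σ a_{i₀i₁i₂i₃} x₀^{i₀}x₁^{i₁}x₂^{i₂}x₃^{i₃} a quartic form with a_{i₀i₁00} = 0, so the line ℓ : x₀ = x₁ = 0 lies on X = {F = 0}. Suppose ℓ has positive degree d and is of the first kind, i.e., its resultant R(ℓ) ∈ K[x₂,x₃] is not identically zero. Then the number of lines lying on X, distinct from ℓ, which meet ℓ at points that are smooth points of X, is at most 3 + 5d. -/

import Mathlib

open MvPolynomial

noncomputable section

/-- The exponent vector `(a, b, c, d)` as a monomial index for `MvPolynomial (Fin 4)`. -/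
def expo (a b c d : ℕ) : Fin 4 →₀ ℕ := Finsupp.equivFunOnFinite.symm ![a, b, c, d]

/-- The line `ℓ : x₀ = x₁ = 0`. -/
def ell (K : Type*) [Field K] : Submodule K (Fin 4 → K) :=
  Submodule.span K {![0, 0, 1, 0], ![0, 0, 0, 1]}

variable (K : Type*) [Field K]

/-- The binary cubic form `α = Σ_{j+k=3} a_{10jk} x₂^j x₃^k`, where `X 0 = x₂`,
`X 1 = x₃`. -/
def alphaForm (F : MvPolynomial (Fin 4) K) : MvPolynomial (Fin 2) K :=
  ∑ j ∈ Finset.range 4, C (coeff (expo 1 0 j (3 - j)) F) * X 0 ^ j * X 1 ^ (3 - j)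

/-- The binary cubic form `β = Σ_{j+k=3} a_{01jk} x₂^j x₃^k`. -/
def betaForm (F : MvPolynomial (Fin 4) K) : MvPolynomial (Fin 2) K :=
  ∑ j ∈ Finset.range 4, C (coeff (expo 0 1 j (3 - j)) F) * X 0 ^ j * X 1 ^ (3 - j)

/-- The coefficient `c_{ijk}(t) = Σ_{i₀+i₁=i+1} a_{i₀i₁jk}·t^{i₀} ∈ K[t]` of the
monomial `x₁^i x₂^j x₃^k` in the residual cubic `g_t = F(t·x₁,x₁,x₂,x₃)/x₁`. -/
def cc (F : MvPolynomial (Fin 4) K) (i j k : ℕ) : Polynomial K :=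
  ∑ i0 ∈ Finset.range (i + 2),
    Polynomial.C (coeff (expo i0 (i + 1 - i0) j k) F) * Polynomial.X ^ i0

/-- The characteristic-2 hessian `h̃ ∈ K[t][x₂,x₃]` of the residual cubic, i.e. the
reduction modulo 2 of `(1/4)·((1/2)·det(∂²g/∂xᵢ∂xⱼ) − m²·g)|_{x₁=0}` computed with
generic integer coefficients, written out explicitly.  It is an element of
`Polynomial (MvPolynomial (Fin 2) K)` (a polynomial in `t` whose coefficients are
binary forms in `x₂ = X 0`, `x₃ = X 1`). -/
def hTilde (F : MvPolynomial (Fin 4) K) : Polynomial (MvPolynomial (Fin 2) K) :=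
  let c : ℕ → ℕ → ℕ → Polynomial (MvPolynomial (Fin 2) K) := fun i j k =>
    (cc K F i j k).map (MvPolynomial.C : K →+* MvPolynomial (Fin 2) K)
  (c 0 0 3 * c 0 2 1 * c 2 0 1 + c 0 0 3 * c 1 1 1 ^ 2 + c 0 1 2 ^ 2 * c 2 0 1
      + c 0 1 2 * c 1 0 2 * c 1 1 1 + c 0 2 1 * c 1 0 2 ^ 2)
    * Polynomial.C (X 1 ^ 3)
  + (c 0 0 3 * c 0 2 1 * c 2 1 0 + c 0 0 3 * c 0 3 0 * c 2 0 1
      + c 0 0 3 * c 1 1 1 * c 1 2 0 + c 0 1 2 ^ 2 * c 2 1 0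
      + c 0 1 2 * c 0 2 1 * c 2 0 1 + c 0 3 0 * c 1 0 2 ^ 2)
    * Polynomial.C (X 0 * X 1 ^ 2)
  + (c 0 0 3 * c 0 3 0 * c 2 1 0 + c 0 0 3 * c 1 2 0 ^ 2
      + c 0 1 2 * c 0 2 1 * c 2 1 0 + c 0 1 2 * c 0 3 0 * c 2 0 1
      + c 0 2 1 ^ 2 * c 2 0 1 + c 0 3 0 * c 1 0 2 * c 1 1 1)
    * Polynomial.C (X 0 ^ 2 * X 1)
  + (c 0 1 2 * c 0 3 0 * c 2 1 0 + c 0 1 2 * c 1 2 0 ^ 2 + c 0 2 1 ^ 2 * c 2 1 0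
      + c 0 2 1 * c 1 1 1 * c 1 2 0 + c 0 3 0 * c 1 1 1 ^ 2)
    * Polynomial.C (X 0 ^ 3)

/-- The Sylvester matrix of two polynomials `p`, `q` taken with formal degrees 1
and 5 respectively: five staggered rows of coefficients of `p` and one row of
coefficients of `q`. -/
def sylvester15 {A : Type*} [CommRing A] (p q : Polynomial A) :
    Matrix (Fin 6) (Fin 6) A :=
  Matrix.of fun i j =>
    if (i : ℕ) < 5 then
      (if (i : ℕ) ≤ (j : ℕ) ∧ (j : ℕ) ≤ (i : ℕ) + 1 then p.coeff ((i : ℕ) + 1 - (j : ℕ))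
       else 0)
    else q.coeff (5 - (j : ℕ))

/-- The resultant `R(ℓ) = Res_t(t·α̃ + β̃, h̃) ∈ K[x₂,x₃]` of the line
`ℓ : x₀ = x₁ = 0`, computed as the determinant of the Sylvester matrix with formal
degrees 1 and 5 in `t`. -/
def lineResultant (F : MvPolynomial (Fin 4) K)
    (alphaRed betaRed : MvPolynomial (Fin 2) K) : MvPolynomial (Fin 2) K :=
  (sylvester15 (Polynomial.C alphaRed * Polynomial.X + Polynomial.C betaRed)
    (hTilde K F)).det

end

/-- The ternary cubic with coefficients `c i j k`, evaluated at `(z, x, y)`. -/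
def cubicForm {A : Type*} [CommRing A] (c : ℕ → ℕ → ℕ → A) (z x y : A) : A :=
  ∑ i ∈ Finset.range 4, ∑ j ∈ Finset.range (4 - i),
    c i j (3 - i - j) * z ^ i * x ^ j * y ^ (3 - i - j)

/-- The characteristic-2 hessian of a ternary cubic with coefficients `c i j k`, restricted to
the line where the first coordinate vanishes. -/
def cubicHessian {A : Type*} [CommRing A] (c : ℕ → ℕ → ℕ → A) (x y : A) : A :=
  (c 0 0 3 * c 0 2 1 * c 2 0 1 + c 0 0 3 * c 1 1 1 ^ 2 + c 0 1 2 ^ 2 * c 2 0 1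
      + c 0 1 2 * c 1 0 2 * c 1 1 1 + c 0 2 1 * c 1 0 2 ^ 2) * y ^ 3
  + (c 0 0 3 * c 0 2 1 * c 2 1 0 + c 0 0 3 * c 0 3 0 * c 2 0 1
      + c 0 0 3 * c 1 1 1 * c 1 2 0 + c 0 1 2 ^ 2 * c 2 1 0
      + c 0 1 2 * c 0 2 1 * c 2 0 1 + c 0 3 0 * c 1 0 2 ^ 2) * (x * y ^ 2)
  + (c 0 0 3 * c 0 3 0 * c 2 1 0 + c 0 0 3 * c 1 2 0 ^ 2
      + c 0 1 2 * c 0 2 1 * c 2 1 0 + c 0 1 2 * c 0 3 0 * c 2 0 1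
      + c 0 2 1 ^ 2 * c 2 0 1 + c 0 3 0 * c 1 0 2 * c 1 1 1) * (x ^ 2 * y)
  + (c 0 1 2 * c 0 3 0 * c 2 1 0 + c 0 1 2 * c 1 2 0 ^ 2 + c 0 2 1 ^ 2 * c 2 1 0
      + c 0 2 1 * c 1 1 1 * c 1 2 0 + c 0 3 0 * c 1 1 1 ^ 2) * x ^ 3

/-- The coefficients of the cubic after the substitution `x ↦ x + p * y`. -/
def shear {A : Type*} [CommRing A] (c : ℕ → ℕ → ℕ → A) (p : A) (i j k : ℕ) : A :=
  ∑ m ∈ Finset.range (k + 1), (Nat.choose (j + m) m : A) * p ^ m * c i (j + m) (k - m)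

theorem map_cubicForm {A B : Type*} [CommRing A] [CommRing B] (f : A →+* B)
    (c : ℕ → ℕ → ℕ → A) (z x y : A) :
    f (cubicForm c z x y) = cubicForm (fun i j k => f (c i j k)) (f z) (f x) (f y) := by
  simp [cubicForm]

theorem map_cubicHessian {A B : Type*} [CommRing A] [CommRing B] (f : A →+* B)
    (c : ℕ → ℕ → ℕ → A) (x y : A) :
    f (cubicHessian c x y) = cubicHessian (fun i j k => f (c i j k)) (f x) (f y) := by
  simp [cubicHessian]

theorem map_shear {A B : Type*} [CommRing A] [CommRing B] (f : A →+* B)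
    (c : ℕ → ℕ → ℕ → A) (p : A) (i j k : ℕ) :
    f (shear c p i j k) = shear (fun i j k => f (c i j k)) (f p) i j k := by
  simp [shear]

theorem cubicForm_swap {A : Type*} [CommRing A] (c : ℕ → ℕ → ℕ → A) (z x y : A) :
    cubicForm (fun i j k => c i k j) z y x = cubicForm c z x y := by
  simp [cubicForm, Finset.sum_range_succ]
  ring

theorem cubicHessian_swap {A : Type*} [CommRing A] (c : ℕ → ℕ → ℕ → A) (x y : A) :
    cubicHessian (fun i j k => c i k j) y x = cubicHessian c x y := by
  simp only [cubicHessian]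
  ring

theorem cubicForm_shear {A : Type*} [CommRing A] (c : ℕ → ℕ → ℕ → A) (p z x y : A) :
    cubicForm (shear c p) z x y = cubicForm c z (x + p * y) y := by
  simp [cubicForm, shear, Finset.sum_range_succ, Nat.choose]
  ring

theorem cubicHessian_shear {A : Type*} [CommRing A] [CharP A 2] (c : ℕ → ℕ → ℕ → A)
    (p x y : A) :
    cubicHessian c (x + p * y) y = cubicHessian (shear c p) x y +
      (p * c 1 1 1 * c 1 2 0 + p ^ 2 * c 1 2 0 ^ 2) * cubicForm (shear c p) 0 x y := by
  have h2 : (2 : A) = 0 := CharTwo.two_eq_zero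
  have h3 : (3 : A) = 1 := by linear_combination h2
  have e1 : shear c p 0 0 3 = c 0 0 3 + p * c 0 1 2 + p ^ 2 * c 0 2 1 + p ^ 3 * c 0 3 0 := by
    simp [shear, Finset.sum_range_succ]
  have e2 : shear c p 0 1 2 = c 0 1 2 + p ^ 2 * c 0 3 0 := by
    simp [shear, Finset.sum_range_succ, Nat.choose, h2, h3]
  have e3 : shear c p 0 2 1 = c 0 2 1 + p * c 0 3 0 := by
    simp [shear, Finset.sum_range_succ, Nat.choose, h3]
  have e4 : shear c p 0 3 0 = c 0 3 0 := by simp [shear]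
  have e5 : shear c p 1 0 2 = c 1 0 2 + p * c 1 1 1 + p ^ 2 * c 1 2 0 := by
    simp [shear, Finset.sum_range_succ]
  have e6 : shear c p 1 1 1 = c 1 1 1 := by
    simp [shear, Finset.sum_range_succ, Nat.choose, h2]
  have e7 : shear c p 1 2 0 = c 1 2 0 := by simp [shear]
  have e8 : shear c p 2 0 1 = c 2 0 1 + p * c 2 1 0 := by simp [shear, Finset.sum_range_succ]
  have e9 : shear c p 2 1 0 = c 2 1 0 := by simp [shear]
  simp [cubicHessian, cubicForm, Finset.sum_range_succ, e1, e2, e3, e4, e5, e6, e7, e8, e9]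
  generalize c 0 0 3 = c003
  generalize c 0 1 2 = c012
  generalize c 0 2 1 = c021
  generalize c 0 3 0 = c030
  generalize c 1 0 2 = c102
  generalize c 1 1 1 = c111
  generalize c 1 2 0 = c120
  generalize c 2 0 1 = c201
  generalize c 2 1 0 = c210
  have h4 : (4 : A) = 0 := by linear_combination 2 * h2
  have h5 : (5 : A) = 1 := by linear_combination 2 * h2
  ring_nf
  simp only [h2, h3, h4, h5, mul_zero, mul_one, add_zero]

theorem coeff_eq_zero_of_forall_sum_pow {K : Type*} [Field K] (T : Finset K) (a : ℕ → K) (n : ℕ)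
    (hn : n ≤ T.card) (h : ∀ u ∈ T, ∑ i ∈ Finset.range n, a i * u ^ i = 0) (i : ℕ) (hi : i < n) :
    a i = 0 := by
  have hp : (∑ i ∈ Finset.range n, Polynomial.C (a i) * Polynomial.X ^ i) = 0 := by
    apply Polynomial.eq_zero_of_degree_lt_of_eval_finset_eq_zero T
    · refine lt_of_lt_of_le ?_ (Nat.cast_le.2 hn)
      rw [Polynomial.degree_lt_iff_coeff_zero]
      intro m hm
      simp only [Polynomial.finsetSum_coeff, Polynomial.coeff_C_mul_X_pow]
      exact Finset.sum_eq_zero fun j hj => if_neg (by have := Finset.mem_range.1 hj; omega)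
    · intro u hu
      simpa [Polynomial.eval_finsetSum] using h u hu
  have := congrArg (fun q => Polynomial.coeff q i) hp
  simpa [Polynomial.finsetSum_coeff, Polynomial.coeff_C_mul_X_pow, hi] using this

theorem cubicForm_zero_left {A : Type*} [CommRing A] (c : ℕ → ℕ → ℕ → A) (x y : A) :
    cubicForm c 0 x y = c 0 0 3 * y ^ 3 + c 0 1 2 * (x * y ^ 2) + c 0 2 1 * (x ^ 2 * y)
      + c 0 3 0 * x ^ 3 := by
  simp [cubicForm, Finset.sum_range_succ]
  ring

theorem pow_dvd_binary_cubic {A : Type*} [CommRing A] {a b c d x y : A} {n : ℕ} (hn : n ≤ 3)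
    (ha : 1 ≤ n → a = 0) (hb : 2 ≤ n → b = 0) (hc : 3 ≤ n → c = 0) :
    x ^ n ∣ a * y ^ 3 + b * (x * y ^ 2) + c * (x ^ 2 * y) + d * x ^ 3 := by
  interval_cases n
  · simp
  · exact ⟨b * y ^ 2 + c * x * y + d * x ^ 2, by rw [ha le_rfl]; ring⟩
  · exact ⟨c * y + d * x, by rw [ha (by norm_num), hb le_rfl]; ring⟩
  · exact ⟨d, by rw [ha (by norm_num), hb (by norm_num), hc le_rfl]; ring⟩

theorem coeffs_eq_zero_of_forall_mul_eq_zero {K : Type*} [Field K] [Infinite K] (e₀ e₁ e₂ e₃ : K)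
    (h : ∀ l : K, l * (e₀ + e₁ * l + e₂ * l ^ 2 + e₃ * l ^ 3) = 0) :
    e₀ = 0 ∧ e₁ = 0 ∧ e₂ = 0 ∧ e₃ = 0 := by
  obtain ⟨T, hT⟩ := Infinite.exists_subset_card_eq K 5
  have key := coeff_eq_zero_of_forall_sum_pow T (fun i => [0, e₀, e₁, e₂, e₃].getD i 0) 5 hT.ge
    (fun u _ => by
      simp [Finset.sum_range_succ]
      linear_combination h u)
  exact ⟨by simpa using key 1, by simpa using key 2, by simpa using key 3, by simpa using key 4⟩

theorem shear_relations {K : Type*} [Field K] [Infinite K] (c : ℕ → ℕ → ℕ → K) (p u : K)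
    (h : ∀ l : K, l * cubicForm c l (l * u + p) 1 = 0) :
    shear c p 0 0 3 = 0 ∧ shear c p 1 0 2 + shear c p 0 1 2 * u = 0 ∧
      shear c p 2 0 1 + shear c p 1 1 1 * u + shear c p 0 2 1 * u ^ 2 = 0 ∧
      shear c p 3 0 0 + shear c p 2 1 0 * u + shear c p 1 2 0 * u ^ 2
        + shear c p 0 3 0 * u ^ 3 = 0 := by
  apply coeffs_eq_zero_of_forall_mul_eq_zero
  intro l
  rw [← h l]
  have := cubicForm_shear c p l (l * u) 1
  rw [mul_one] at this
  rw [← this]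
  simp only [cubicForm, Finset.sum_range_succ, Finset.sum_range_zero]
  ring

/-- If `#T` distinct lines through the point `(0, p, 1)` lie on a ternary cubic, then both the
cubic and its hessian vanish to order `#T` at that point along the line `z = 0`. -/
theorem pow_card_dvd {K : Type*} [Field K] [Infinite K] [CharP K 2] {A : Type*} [CommRing A]
    [Algebra K A] [CharP A 2] (c : ℕ → ℕ → ℕ → K) (p : K) (T : Finset K)
    (hT : ∀ u ∈ T, ∀ l : K, l * cubicForm c l (l * u + p) 1 = 0) (x y : A)
    (hne : cubicForm (fun i j k => algebraMap K A (c i j k)) 0 x y ≠ 0) :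
    (x - algebraMap K A p * y) ^ T.card ∣
        cubicForm (fun i j k => algebraMap K A (c i j k)) 0 x y ∧
      (x - algebraMap K A p * y) ^ T.card ∣
        cubicHessian (fun i j k => algebraMap K A (c i j k)) x y := by
  obtain ⟨L, hL⟩ : ∃ L, L = x - algebraMap K A p * y := ⟨_, rfl⟩
  obtain rfl : x = L + algebraMap K A p * y := by rw [hL]; ring
  rw [cubicHessian_shear, ← cubicForm_shear] at *
  rw [← hL]
  have hmap := map_shear (algebraMap K A) c p
  suffices H : L ^ T.card ∣ cubicForm (shear (fun i j k => algebraMap K A (c i j k))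
        (algebraMap K A p)) 0 L y ∧
      L ^ T.card ∣ cubicHessian (shear (fun i j k => algebraMap K A (c i j k))
        (algebraMap K A p)) L y from
    ⟨H.1, dvd_add H.2 (H.1.mul_left _)⟩
  have hrel := fun u hu => shear_relations c p u (hT u hu)
  simp only [← funext fun i => funext fun j => funext fun k => hmap i j k] at hne ⊢
  generalize shear c p = s at *
  have h₁ : 1 ≤ T.card → s 0 0 3 = 0 := fun h => by
    obtain ⟨u, hu⟩ := Finset.card_pos.1 h
    exact (hrel u hu).1
  have h₂ : 2 ≤ T.card → s 1 0 2 = 0 ∧ s 0 1 2 = 0 := fun h => by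
    have key := coeff_eq_zero_of_forall_sum_pow T (fun i => [s 1 0 2, s 0 1 2].getD i 0) 2 h
      (fun u hu => by
        simp [Finset.sum_range_succ]
        linear_combination (hrel u hu).2.1)
    exact ⟨by simpa using key 0, by simpa using key 1⟩
  have h₃ : 3 ≤ T.card → s 2 0 1 = 0 ∧ s 1 1 1 = 0 ∧ s 0 2 1 = 0 := fun h => by
    have key := coeff_eq_zero_of_forall_sum_pow T
      (fun i => [s 2 0 1, s 1 1 1, s 0 2 1].getD i 0) 3 h
      (fun u hu => by
        simp [Finset.sum_range_succ]
        linear_combination (hrel u hu).2.2.1)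
    exact ⟨by simpa using key 0, by simpa using key 1, by simpa using key 2⟩
  have h₄ : 4 ≤ T.card → s 0 3 0 = 0 := fun h => by
    have key := coeff_eq_zero_of_forall_sum_pow T
      (fun i => [s 3 0 0, s 2 1 0, s 1 2 0, s 0 3 0].getD i 0) 4 h
      (fun u hu => by
        simp [Finset.sum_range_succ]
        linear_combination (hrel u hu).2.2.2)
    simpa using key 3
  rcases Nat.lt_or_ge T.card 4 with hlt | hge
  swap
  · refine absurd ?_ hne
    simp [cubicForm_zero_left, h₁ (by omega), h₂ (by omega), h₃ (by omega), h₄ hge]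
  have hz : 1 ≤ T.card → s 0 0 3 * s 0 2 1 * s 2 0 1 + s 0 0 3 * s 1 1 1 ^ 2
      + s 0 1 2 ^ 2 * s 2 0 1 + s 0 1 2 * s 1 0 2 * s 1 1 1 + s 0 2 1 * s 1 0 2 ^ 2 = 0 := by
    intro h
    obtain ⟨u, hu⟩ := Finset.card_pos.1 h
    obtain ⟨r₀, r₁, r₂, -⟩ := hrel u hu
    have q₁ : s 1 0 2 = s 0 1 2 * u := by
      linear_combination r₁ - s 0 1 2 * u * CharTwo.two_eq_zero (R := K)
    rw [q₁, r₀]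
    linear_combination s 0 1 2 ^ 2 * r₂
  constructor
  · rw [cubicForm_zero_left]
    exact pow_dvd_binary_cubic (by omega) (fun h => by simp [h₁ h]) (fun h => by simp [h₂ h])
      (fun h => by simp [h₃ h])
  · apply pow_dvd_binary_cubic (by omega)
    · intro h
      simpa only [map_add, map_mul, map_pow, map_zero] using congrArg (algebraMap K A) (hz h)
    · intro h
      simp [h₁ (by omega), h₂ h]
    · intro h
      simp [h₁ (by omega), h₂ (by omega), h₃ h]

/-- The value at `(a, b)` of the binary form of degree `i + 1` which homogenizes the coefficient of
`z ^ i * x ^ j * y ^ k` in the residual cubics of the planes through the line. -/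
noncomputable def residualCoeff {K : Type*} [Field K] (F : MvPolynomial (Fin 4) K) {B : Type*}
    [CommRing B] [Algebra K B] (a b : B) (i j k : ℕ) : B :=
  ∑ i0 ∈ Finset.range (i + 2),
    algebraMap K B (coeff (expo i0 (i + 1 - i0) j k) F) * a ^ i0 * b ^ (i + 1 - i0)

theorem map_residualCoeff {K : Type*} [Field K] (F : MvPolynomial (Fin 4) K) {B B' : Type*}
    [CommRing B] [Algebra K B] [CommRing B'] [Algebra K B'] (f : B →ₐ[K] B') (a b : B)
    (i j k : ℕ) : f (residualCoeff F a b i j k) = residualCoeff F (f a) (f b) i j k := by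
  simp [residualCoeff]

theorem residualCoeff_mul {K : Type*} [Field K] (F : MvPolynomial (Fin 4) K) {B : Type*}
    [CommRing B] [Algebra K B] (s a b : B) (i j k : ℕ) :
    residualCoeff F (s * a) (s * b) i j k = s ^ (i + 1) * residualCoeff F a b i j k := by
  rw [residualCoeff, residualCoeff, Finset.mul_sum]
  refine Finset.sum_congr rfl fun n hn => ?_
  have : i + 1 = n + (i + 1 - n) := by have := Finset.mem_range.1 hn; omega
  rw [mul_pow, mul_pow]
  conv_rhs => rw [this, pow_add]
  simp only [Nat.add_sub_cancel_left]
  ring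

theorem cubicHessian_mul {A : Type*} [CommRing A] (c : ℕ → ℕ → ℕ → A) (s x y : A) :
    cubicHessian (fun i j k => s ^ (i + 1) * c i j k) x y = s ^ 5 * cubicHessian c x y := by
  simp only [cubicHessian]
  ring

theorem det_sylvester15 {A : Type*} [CommRing A] (u v : A) (q : Polynomial A) :
    (sylvester15 (Polynomial.C u * Polynomial.X + Polynomial.C v) q).det =
      ∑ j ∈ Finset.range 6, q.coeff j * u ^ (5 - j) * (-v) ^ j := by
  simp [Matrix.det_succ_row_zero, Fin.sum_univ_succ, sylvester15, Fin.succAbove,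
    Finset.sum_range_succ, Polynomial.coeff_X, Polynomial.coeff_C]
  ring

theorem eval_homogenize_eq_sum {A : Type*} [CommRing A] (u v : A) (q : Polynomial A) (n : ℕ) :
    eval ![v, u] (q.homogenize n) =
      ∑ j ∈ Finset.range (n + 1), q.coeff j * u ^ (n - j) * v ^ j := by
  simp only [Polynomial.homogenize, Finset.Nat.sum_antidiagonal_eq_sum_range_succ_mk, map_sum]
  refine Finset.sum_congr rfl fun j _ => ?_
  rw [eval_monomial, Finsupp.update_eq_add_single (by simp), Finsupp.prod_add_index' (by simp)
    (by simp [pow_add])]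
  simp
  ring

theorem isHomogeneous_residualCoeff {K : Type*} [Field K] (F : MvPolynomial (Fin 4) K)
    {A : Type*} [CommRing A] [Algebra K A] (i j k : ℕ) :
    (residualCoeff F (X 0 : MvPolynomial (Fin 2) A) (X 1) i j k).IsHomogeneous (i + 1) := by
  refine IsHomogeneous.sum _ _ _ fun n hn => ?_
  have : i + 1 = 0 + n + (i + 1 - n) := by have := Finset.mem_range.1 hn; omega
  rw [this, MvPolynomial.algebraMap_apply]
  simp only [zero_add, Nat.add_sub_cancel_left]
  have := ((isHomogeneous_C (Fin 2) (algebraMap K A (coeff (expo n (i + 1 - n) j k) F))).mul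
    (isHomogeneous_X_pow (0 : Fin 2) n)).mul (isHomogeneous_X_pow (1 : Fin 2) (i + 1 - n))
  simpa using this

theorem cubicHessian_mem {A : Type*} [CommRing A] (S : AddSubmonoid A) (c : ℕ → ℕ → ℕ → A)
    (x y : A)
    (h : ∀ i j k i' j' k' i'' j'' k'' m n : ℕ, i + i' + i'' = 2 → m + n = 3 →
      c i j k * c i' j' k' * c i'' j'' k'' * (x ^ m * y ^ n) ∈ S) :
    cubicHessian c x y ∈ S := by
  have h' : ∀ m n : ℕ, m + n = 3 → ∀ i j k i' j' k' i'' j'' k'' : ℕ, i + i' + i'' = 2 →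
      c i j k * c i' j' k' * c i'' j'' k'' * (x ^ m * y ^ n) ∈ S :=
    fun m n hmn i j k i' j' k' i'' j'' k'' hi => h i j k i' j' k' i'' j'' k'' m n hi hmn
  have h₀ := h' 0 3 rfl
  have h₁ := h' 1 2 rfl
  have h₂ := h' 2 1 rfl
  have h₃ := h' 3 0 rfl
  rw [pow_zero, one_mul] at h₀
  rw [pow_one] at h₁ h₂
  rw [pow_zero, mul_one] at h₃
  simp only [cubicHessian, add_mul, pow_two (c _ _ _), ← mul_assoc (c _ _ _) (c _ _ _) (c _ _ _)]
  repeat' apply add_mem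
  all_goals first
    | exact h₀ _ _ _ _ _ _ _ _ _ rfl
    | exact h₁ _ _ _ _ _ _ _ _ _ rfl
    | exact h₂ _ _ _ _ _ _ _ _ _ rfl
    | exact h₃ _ _ _ _ _ _ _ _ _ rfl

theorem isHomogeneous_cubicHessian {A : Type*} [CommRing A]
    {c : ℕ → ℕ → ℕ → MvPolynomial (Fin 2) A} (hc : ∀ i j k, (c i j k).IsHomogeneous (i + 1))
    (x y : A) : (cubicHessian c (C x) (C y)).IsHomogeneous 5 := by
  refine cubicHessian_mem (homogeneousSubmodule (Fin 2) A 5).toAddSubmonoid c _ _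
    fun i j k i' j' k' i'' j'' k'' m n hi _ => ?_
  have := (((hc i j k).mul (hc i' j' k')).mul (hc i'' j'' k'')).mul
    (isHomogeneous_C (Fin 2) (x ^ m * y ^ n))
  rw [show i + 1 + (i' + 1) + (i'' + 1) + 0 = 5 by omega] at this
  simpa using this

theorem aeval_X_one_residualCoeff {K : Type*} [Field K] (F : MvPolynomial (Fin 4) K) (i j k : ℕ) :
    aeval ![(Polynomial.X : Polynomial (MvPolynomial (Fin 2) K)), 1]
      (residualCoeff F (X 0 : MvPolynomial (Fin 2) (MvPolynomial (Fin 2) K)) (X 1) i j k) =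
      (cc K F i j k).map (C : K →+* MvPolynomial (Fin 2) K) := by
  simp [residualCoeff, cc, Polynomial.map_sum, MvPolynomial.algebraMap_apply]

theorem homogenize_hTilde {K : Type*} [Field K] (F : MvPolynomial (Fin 4) K) :
    (hTilde K F).homogenize 5 =
      cubicHessian (residualCoeff F (X 0 : MvPolynomial (Fin 2) (MvPolynomial (Fin 2) K)) (X 1))
        (C (X 0)) (C (X 1)) := by
  apply Polynomial.homogenize_eq_of_isHomogeneous
  · exact isHomogeneous_cubicHessian (isHomogeneous_residualCoeff F) _ _
  · rw [← AlgHom.coe_toRingHom, map_cubicHessian]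
    simp only [AlgHom.coe_toRingHom, aeval_X_one_residualCoeff, algHom_C]
    simp only [cubicHessian, hTilde, Polynomial.algebraMap_eq, map_mul, map_pow]

/-- The resultant of a line is the hessian of the residual cubics of the planes tangent along the
line. -/
theorem lineResultant_eq {K : Type*} [Field K] [CharP K 2] (F : MvPolynomial (Fin 4) K)
    (α β : MvPolynomial (Fin 2) K) :
    lineResultant K F α β = cubicHessian (residualCoeff F β α) (X 0) (X 1) := by
  rw [lineResultant, det_sylvester15, CharTwo.neg_eq, ← eval_homogenize_eq_sum α β _ 5,
    homogenize_hTilde, map_cubicHessian]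
  simp [residualCoeff, MvPolynomial.algebraMap_apply]
  rfl

theorem monomial_expo {K : Type*} [Field K] (a b c d : ℕ) (r : K) :
    monomial (expo a b c d) r = C r * (X 0 ^ a * X 1 ^ b * X 2 ^ c * X 3 ^ d) := by
  rw [monomial_eq, Finsupp.prod_fintype _ _ (by simp)]
  simp [Fin.prod_univ_four, expo]

theorem IsHomogeneous.eq_sum_expo {K : Type*} [Field K] {F : MvPolynomial (Fin 4) K}
    (hhom : F.IsHomogeneous 4) :
    F = ∑ n ∈ Finset.range 5, ∑ j ∈ Finset.range (5 - n), ∑ i ∈ Finset.range (n + 1),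
      C (coeff (expo i (n - i) j (4 - n - j)) F) *
        (X 0 ^ i * X 1 ^ (n - i) * X 2 ^ j * X 3 ^ (4 - n - j)) := by
  simp only [← monomial_expo]
  simp only [Finset.sum_sigma']
  set s := (Finset.range 5).sigma fun n =>
    (Finset.range (5 - n)).sigma fun _ => Finset.range (n + 1)
    with hs
  have hinj : Set.InjOn
      (fun x : (Σ _ : ℕ, Σ _ : ℕ, ℕ) => expo x.2.2 (x.1 - x.2.2) x.2.1 (4 - x.1 - x.2.1)) s := by
    rintro ⟨n, j, i⟩ hx ⟨n', j', i'⟩ hy h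
    simp only [hs, Finset.coe_sigma, Set.mem_sigma_iff, Finset.coe_range, Set.mem_Iio] at hx hy
    have e := fun m : Fin 4 => DFunLike.congr_fun h m
    have e0 := e 0
    have e1 := e 1
    have e2 := e 2
    simp [expo] at e0 e1 e2
    obtain rfl : i = i' := e0
    obtain rfl : j = j' := e2
    obtain rfl : n = n' := by omega
    rfl
  have hsub : F.support ⊆ s.image
      (fun x : (Σ _ : ℕ, Σ _ : ℕ, ℕ) => expo x.2.2 (x.1 - x.2.2) x.2.1 (4 - x.1 - x.2.1)) := by
    intro d hd
    have hdeg : d 0 + d 1 + d 2 + d 3 = 4 := by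
      have := hhom (mem_support_iff.1 hd)
      rw [Finsupp.weight_apply, Finsupp.sum_fintype _ _ (by simp)] at this
      simpa [Fin.sum_univ_four] using this
    refine Finset.mem_image.2 ⟨⟨d 0 + d 1, d 2, d 0⟩, ?_, ?_⟩
    · simp only [hs, Finset.mem_sigma, Finset.mem_range]
      omega
    · ext m
      fin_cases m <;> simp [expo]; omega
  calc F = ∑ d ∈ F.support, monomial d (coeff d F) := F.as_sum
    _ = ∑ d ∈ s.image _, monomial d (coeff d F) :=
        Finset.sum_subset hsub fun d _ hd => by simp [notMem_support_iff.1 hd]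
    _ = _ := Finset.sum_image hinj

theorem eval_mul_eq_cubicForm {K : Type*} [Field K] {F : MvPolynomial (Fin 4) K}
    (hhom : F.IsHomogeneous 4) (hline : ∀ i₂ i₃ : ℕ, coeff (expo 0 0 i₂ i₃) F = 0)
    (l a b x y : K) :
    eval ![l * a, l * b, x, y] F = l * cubicForm (residualCoeff F a b) l x y := by
  conv_lhs => rw [IsHomogeneous.eq_sum_expo hhom]
  rw [Finset.sum_range_succ', cubicForm, map_add, Finset.mul_sum, map_sum]
  have h0 : eval ![l * a, l * b, x, y] (∑ j ∈ Finset.range (5 - 0), ∑ i ∈ Finset.range (0 + 1),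
      C (coeff (expo i (0 - i) j (4 - 0 - j)) F) *
        (X 0 ^ i * X 1 ^ (0 - i) * X 2 ^ j * X 3 ^ (4 - 0 - j))) = 0 := by
    simp [hline]
  rw [h0, add_zero]
  refine Finset.sum_congr rfl fun i _ => ?_
  rw [Nat.add_sub_add_right 4 1 i, Finset.mul_sum, map_sum]
  refine Finset.sum_congr rfl fun j _ => ?_
  rw [residualCoeff, Nat.add_sub_add_right 3 1 i, Finset.sum_mul, Finset.sum_mul, Finset.sum_mul,
    Finset.mul_sum, map_sum]
  refine Finset.sum_congr rfl fun m hm => ?_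
  have hm' : l * l ^ i = l ^ m * l ^ (i + 1 - m) := by
    rw [← pow_add, ← pow_succ']
    have := Finset.mem_range.1 hm
    congr 1
    omega
  simp [mul_pow]
  linear_combination -(coeff (expo m (i + 1 - m) j (3 - i - j)) F * a ^ m * b ^ (i + 1 - m) *
    x ^ j * y ^ (3 - i - j)) * hm'

theorem eval_alphaForm {K : Type*} [Field K] (F : MvPolynomial (Fin 4) K) (w : Fin 2 → K) :
    eval w (alphaForm K F) = ∑ j ∈ Finset.range 4, coeff (expo 1 0 j (3 - j)) F *
      w 0 ^ j * w 1 ^ (3 - j) := by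
  simp [alphaForm]

theorem eval_betaForm {K : Type*} [Field K] (F : MvPolynomial (Fin 4) K) (w : Fin 2 → K) :
    eval w (betaForm K F) = ∑ j ∈ Finset.range 4, coeff (expo 0 1 j (3 - j)) F *
      w 0 ^ j * w 1 ^ (3 - j) := by
  simp [betaForm]

theorem cubicForm_residualCoeff_zero_left {K : Type*} [Field K] (F : MvPolynomial (Fin 4) K)
    (a b : K) (w : Fin 2 → K) : cubicForm (residualCoeff F a b) 0 (w 0) (w 1) =
      a * eval w (alphaForm K F) + b * eval w (betaForm K F) := by
  rw [cubicForm_zero_left, eval_alphaForm, eval_betaForm]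
  simp [residualCoeff, Finset.sum_range_succ]
  ring

theorem cubicForm_C_residualCoeff_zero_left {K : Type*} [Field K] (F : MvPolynomial (Fin 4) K)
    (a b : K) : cubicForm (fun i j k => C (residualCoeff F a b i j k)) 0
        (X 0 : MvPolynomial (Fin 2) K) (X 1) =
      C a * alphaForm K F + C b * betaForm K F := by
  rw [cubicForm_zero_left, alphaForm, betaForm]
  simp [residualCoeff, Finset.sum_range_succ]
  ring

theorem eval_pderiv_eq_zero {K : Type*} [Field K] {F : MvPolynomial (Fin 4) K}
    (hhom : F.IsHomogeneous 4) (hline : ∀ i₂ i₃ : ℕ, coeff (expo 0 0 i₂ i₃) F = 0)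
    (w : Fin 2 → K) (hα : eval w (alphaForm K F) = 0) (hβ : eval w (betaForm K F) = 0) (i : Fin 4) :
    eval ![0, 0, w 0, w 1] (pderiv i F) = 0 := by
  rw [eval_alphaForm] at hα
  rw [eval_betaForm] at hβ
  rw [IsHomogeneous.eq_sum_expo hhom]
  fin_cases i
  · simp [Finset.sum_range_succ, hline, Derivation.leibniz, Derivation.leibniz_pow,
      pderiv_X] at hα ⊢
    linear_combination hα
  · simp [Finset.sum_range_succ, hline, Derivation.leibniz, Derivation.leibniz_pow,
      pderiv_X] at hβ ⊢
    linear_combination hβ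
  · simp [Finset.sum_range_succ, hline, Derivation.leibniz, Derivation.leibniz_pow, pderiv_X]
  · simp [Finset.sum_range_succ, hline, Derivation.leibniz, Derivation.leibniz_pow, pderiv_X]

theorem dvd_lineResultant {K : Type*} [Field K] [CharP K 2] (F : MvPolynomial (Fin 4) K)
    {α β D : MvPolynomial (Fin 2) K} {a b : K} (hab : a ≠ 0 ∨ b ≠ 0) (h : D ∣ C a * α + C b * β)
    (hD : D ∣ cubicHessian (fun i j k => C (residualCoeff F a b i j k)) (X 0) (X 1)) :
    D ∣ lineResultant K F α β := by
  rw [lineResultant_eq]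
  let π := Ideal.Quotient.mkₐ K (Ideal.span {D})
  have hπ : ∀ z, π z = 0 ↔ D ∣ z := fun z => by
    rw [Ideal.Quotient.mkₐ_eq_mk, Ideal.Quotient.eq_zero_iff_mem, Ideal.mem_span_singleton]
  have hC : ∀ r : K, π (C r) = algebraMap K _ r := fun r => π.commutes r
  have h2 : algebraMap K (MvPolynomial (Fin 2) K ⧸ Ideal.span {D}) 2 = 0 := by
    exact (congrArg (algebraMap K _) (CharTwo.two_eq_zero (R := K))).trans (map_zero _)
  rw [← hπ, map_add, map_mul, map_mul, hC, hC] at h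
  rw [← hπ, ← AlgHom.coe_toRingHom, map_cubicHessian] at hD ⊢
  have hres : ∀ i j k, π (C (residualCoeff F a b i j k)) =
      residualCoeff F (algebraMap K _ a) (algebraMap K _ b) i j k := fun i j k => by
    rw [hC]
    exact map_residualCoeff F (Algebra.ofId K _) a b i j k
  simp only [AlgHom.coe_toRingHom, hres, map_residualCoeff] at hD ⊢
  have key : ∀ r s t, r * π β = t * algebraMap K _ a → r * π α = t * algebraMap K _ b →
      r * s = 1 → cubicHessian (residualCoeff F (π β) (π α)) (π (X 0)) (π (X 1)) = 0 := by
    intro r s t h₁ h₂ hrs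
    have e : r ^ 5 * cubicHessian (residualCoeff F (π β) (π α)) (π (X 0)) (π (X 1)) = 0 := by
      rw [← cubicHessian_mul]
      simp only [← residualCoeff_mul, h₁, h₂]
      simp only [residualCoeff_mul, cubicHessian_mul]
      exact mul_eq_zero_of_right _ hD
    linear_combination s ^ 5 * e - cubicHessian (residualCoeff F (π β) (π α)) (π (X 0)) (π (X 1)) *
      (congrArg (· ^ 5) hrs)
  rw [map_ofNat] at h2
  have hinv : ∀ r : K, r ≠ 0 → algebraMap K (MvPolynomial (Fin 2) K ⧸ Ideal.span {D}) r *
      algebraMap K _ r⁻¹ = 1 := fun r hr => by rw [← map_mul, mul_inv_cancel₀ hr, map_one]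
  rcases hab with ha | hb
  · exact key _ _ (π β) (mul_comm _ _)
      (by linear_combination h - algebraMap K _ b * π β * h2) (hinv a ha)
  · exact key _ _ (π α) (by linear_combination h - algebraMap K _ a * π α * h2)
      (mul_comm _ _) (hinv b hb)

theorem totalDegree_residualCoeff_le {K : Type*} [Field K] (F : MvPolynomial (Fin 4) K)
    {a b : MvPolynomial (Fin 2) K} {d : ℕ} (ha : a.totalDegree ≤ d) (hb : b.totalDegree ≤ d)
    (i j k : ℕ) : (residualCoeff F a b i j k).totalDegree ≤ (i + 1) * d := by
  refine totalDegree_finsetSum_le fun n hn => ?_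
  have h₁ := totalDegree_mul (C (coeff (expo n (i + 1 - n) j k) F) * a ^ n) (b ^ (i + 1 - n))
  have h₂ := totalDegree_mul (C (coeff (expo n (i + 1 - n) j k) F)) (a ^ n)
  have h₃ := (totalDegree_pow a n).trans (Nat.mul_le_mul_left n ha)
  have h₄ := (totalDegree_pow b (i + 1 - n)).trans (Nat.mul_le_mul_left (i + 1 - n) hb)
  rw [totalDegree_C] at h₂
  have h₅ : (i + 1) * d = n * d + (i + 1 - n) * d := by
    rw [← add_mul]
    congr 1
    have := Finset.mem_range.1 hn
    omega
  rw [MvPolynomial.algebraMap_apply, Algebra.algebraMap_self, RingHom.id_apply]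
  omega

theorem totalDegree_lineResultant_le {K : Type*} [Field K] [CharP K 2] (F : MvPolynomial (Fin 4) K)
    (α β : MvPolynomial (Fin 2) K) :
    (lineResultant K F α β).totalDegree ≤ 3 + 5 * max α.totalDegree β.totalDegree := by
  rw [lineResultant_eq, ← mem_restrictTotalDegree]
  set d := max α.totalDegree β.totalDegree
  refine cubicHessian_mem (restrictTotalDegree (Fin 2) K (3 + 5 * d)).toAddSubmonoid _ _ _
    fun i j k i' j' k' i'' j'' k'' m n hi hmn => ?_
  rw [Submodule.mem_toAddSubmonoid, mem_restrictTotalDegree]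
  have hd := totalDegree_residualCoeff_le F (le_max_right _ _ : β.totalDegree ≤ d)
    (le_max_left _ _ : α.totalDegree ≤ d)
  refine (totalDegree_mul _ _).trans ((add_le_add ((totalDegree_mul _ _).trans (add_le_add
    ((totalDegree_mul _ _).trans (add_le_add (hd i j k) (hd i' j' k'))) (hd i'' j'' k'')))
    ((totalDegree_mul _ _).trans (add_le_add (totalDegree_X_pow _ _).le
      (totalDegree_X_pow _ _).le))).trans ?_)
  rw [hmn, ← add_mul, ← add_mul, show i + 1 + (i' + 1) + (i'' + 1) = 5 by omega, add_comm]

/-- The point `(1 : 0)` or `(p : 1)` of the projective line. -/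
def basePoint {K : Type*} [Field K] : Option K → Fin 2 → K
  | none => ![1, 0]
  | some p => ![p, 1]

/-- A vector which, for `u ≠ 0`, is independent of the given base point. -/
def slopeVector {K : Type*} [Field K] : Option K → K → Fin 2 → K
  | none, u => ![0, u]
  | some _, u => ![u, 0]

/-- The linear form vanishing at the given base point. -/
noncomputable def vanishingForm {K : Type*} [Field K] : Option K → MvPolynomial (Fin 2) K
  | none => X 1
  | some p => X 0 - C p * X 1

theorem eval_vanishingForm_eq_zero_iff {K : Type*} [Field K] (o o' : Option K) :
    eval (basePoint o') (vanishingForm o) = 0 ↔ o = o' := by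
  rcases o with _ | p <;> rcases o' with _ | p' <;>
    simp [basePoint, vanishingForm, sub_eq_zero, eq_comm]

theorem totalDegree_vanishingForm {K : Type*} [Field K] (o : Option K) :
    (vanishingForm o).totalDegree = 1 := by
  rcases o with _ | p
  · exact totalDegree_X _
  · apply le_antisymm
    · refine (totalDegree_sub _ _).trans (max_le (totalDegree_X _).le ?_)
      refine (totalDegree_mul _ _).trans ?_
      simp
    · refine Nat.one_le_iff_ne_zero.2 fun h => ?_
      rw [totalDegree_eq_zero_iff_eq_C] at h
      have h1 := (eval_vanishingForm_eq_zero_iff (some p) (some p)).2 rfl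
      have h2 := (eval_vanishingForm_eq_zero_iff (some p) none).not.2 (by simp)
      rw [h, eval_C] at h1 h2
      exact h2 h1

theorem irreducible_vanishingForm {K : Type*} [Field K] (o : Option K) :
    Irreducible (vanishingForm o) := by
  refine irreducible_of_totalDegree_eq_one (totalDegree_vanishingForm o) fun x hx => ?_
  refine isUnit_iff_ne_zero.2 fun h0 => ?_
  have h : vanishingForm o = 0 := by
    ext d
    rw [coeff_zero, ← zero_dvd_iff, ← h0]
    exact hx d
  have := totalDegree_vanishingForm o
  rw [h, totalDegree_zero] at this
  exact zero_ne_one this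

theorem isRelPrime_vanishingForm {K : Type*} [Field K] {o o' : Option K} (h : o ≠ o') :
    IsRelPrime (vanishingForm o) (vanishingForm o') := by
  rw [(irreducible_vanishingForm o).isRelPrime_iff_not_dvd]
  rintro ⟨q, hq⟩
  have h1 := (eval_vanishingForm_eq_zero_iff o o).2 rfl
  have h2 := (eval_vanishingForm_eq_zero_iff o' o).not.2 h.symm
  rw [hq, eval_mul, h1, zero_mul] at h2
  exact h2 rfl

theorem linear_combination_ne_zero {K σ : Type*} [Field K] {α β : MvPolynomial σ K}
    (hcop : IsRelPrime α β) (hd : 1 ≤ max α.totalDegree β.totalDegree) {a b : K}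
    (hab : a ≠ 0 ∨ b ≠ 0) : C a * α + C b * β ≠ 0 := by
  have key : ∀ {α β : MvPolynomial σ K} {a b : K}, IsRelPrime α β → b ≠ 0 →
      C a * α + C b * β = 0 → max α.totalDegree β.totalDegree = 0 := by
    intro α β a b hcop hb h
    have hβ : β = C (-(a / b)) * α := by
      have h1 : (C b * C b⁻¹ : MvPolynomial σ K) = 1 := by rw [← C_mul, mul_inv_cancel₀ hb, C_1]
      rw [div_eq_mul_inv, C_neg, C_mul]
      linear_combination C b⁻¹ * h - β * h1
    have hu := hcop dvd_rfl (Dvd.intro_left _ hβ.symm)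
    have hα : α.totalDegree = 0 := (isUnit_iff_totalDegree_of_isReduced.1 hu).2
    have := totalDegree_mul (C (-(a / b))) α
    rw [← hβ, totalDegree_C, hα] at this
    omega
  intro h
  rcases hab with ha | hb
  · have := key hcop.symm ha ((add_comm _ _).trans h)
    rw [max_comm] at this
    omega
  · have := key hcop hb h
    omega

theorem vanishingForm_pow_card_dvd {K : Type*} [Field K] [Infinite K] [CharP K 2]
    {F : MvPolynomial (Fin 4) K} (hhom : F.IsHomogeneous 4)
    (hline : ∀ i₂ i₃ : ℕ, coeff (expo 0 0 i₂ i₃) F = 0)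
    {gam α β : MvPolynomial (Fin 2) K}
    (hfacα : alphaForm K F = gam * α) (hfacβ : betaForm K F = gam * β)
    (hcop : IsRelPrime α β) (hd : 1 ≤ max α.totalDegree β.totalDegree) (o : Option K)
    (hsm : eval (basePoint o) (betaForm K F) ≠ 0 ∨ eval (basePoint o) (alphaForm K F) ≠ 0)
    (T : Finset K)
    (hT : ∀ u ∈ T, ∀ l : K, eval ![l * eval (basePoint o) (betaForm K F),
      l * eval (basePoint o) (alphaForm K F), basePoint o 0 + l * slopeVector o u 0,
      basePoint o 1 + l * slopeVector o u 1] F = 0) :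
    vanishingForm o ^ T.card ∣ lineResultant K F α β := by
  generalize ha : eval (basePoint o) (betaForm K F) = a at *
  generalize hb : eval (basePoint o) (alphaForm K F) = b at *
  have hg : eval (basePoint o) gam ≠ 0 := by
    intro h
    rw [hfacβ, eval_mul, h, zero_mul] at ha
    rw [hfacα, eval_mul, h, zero_mul] at hb
    simp [← ha, ← hb] at hsm
  have hbin := cubicForm_C_residualCoeff_zero_left F a b
  rw [hfacα, hfacβ, show C a * (gam * α) + C b * (gam * β) = gam * (C a * α + C b * β) by ring]
    at hbin
  have hne : gam * (C a * α + C b * β) ≠ 0 :=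
    mul_ne_zero (fun h => hg (by rw [h, map_zero])) (linear_combination_ne_zero hcop hd hsm)
  have hdvd : vanishingForm o ^ T.card ∣
        cubicForm (fun i j k => C (residualCoeff F a b i j k)) 0 (X 0) (X 1) ∧
      vanishingForm o ^ T.card ∣
        cubicHessian (fun i j k => C (residualCoeff F a b i j k)) (X 0) (X 1) := by
    simp only [eval_mul_eq_cubicForm hhom hline] at hT
    rcases o with _ | p
    · have := pow_card_dvd (A := MvPolynomial (Fin 2) K)
        (fun i j k => residualCoeff F a b i k j) 0 T (fun u hu l => by
          rw [cubicForm_swap]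
          simpa [basePoint, slopeVector] using hT u hu l) (X 1) (X 0) (by
          rw [MvPolynomial.algebraMap_eq, cubicForm_swap fun i j k => C (residualCoeff F a b i j k),
            hbin]
          exact hne)
      rw [MvPolynomial.algebraMap_eq, cubicForm_swap fun i j k => C (residualCoeff F a b i j k),
        cubicHessian_swap fun i j k => C (residualCoeff F a b i j k)] at this
      simpa [vanishingForm] using this
    · exact pow_card_dvd (residualCoeff F a b) p T (fun u hu l => by
        simpa [basePoint, slopeVector, add_comm] using hT u hu l) (X 0) (X 1) (by
        rw [MvPolynomial.algebraMap_eq, hbin]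
        exact hne)
  refine dvd_lineResultant F hsm ?_ hdvd.2
  rw [hbin] at hdvd
  refine (irreducible_vanishingForm o).prime.pow_dvd_of_dvd_mul_left _ ?_ hdvd.1
  rintro ⟨q, hq⟩
  rw [hq, eval_mul, (eval_vanishingForm_eq_zero_iff o o).2 rfl, zero_mul] at hg
  exact hg rfl

theorem exists_eq_smul_basePoint {K : Type*} [Field K] {s t : K} (h : s ≠ 0 ∨ t ≠ 0) :
    ∃ (o : Option K) (k : K), k ≠ 0 ∧ s = k * basePoint o 0 ∧ t = k * basePoint o 1 := by
  by_cases ht : t = 0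
  · exact ⟨none, s, by simpa [ht] using h, by simp [basePoint], by simp [basePoint, ht]⟩
  · exact ⟨some (s / t), t, ht, by simp [basePoint, mul_div_cancel₀, ht], by simp [basePoint]⟩

theorem exists_eq_smul_basePoint_add_slopeVector {K : Type*} [Field K] (o : Option K) (s t : K) :
    ∃ k u : K, s = k * basePoint o 0 + slopeVector o u 0 ∧
      t = k * basePoint o 1 + slopeVector o u 1 := by
  rcases o with _ | p
  · exact ⟨s, t, by simp [basePoint, slopeVector], by simp [basePoint, slopeVector]⟩
  · exact ⟨t, s - t * p, by simp [basePoint, slopeVector], by simp [basePoint, slopeVector]⟩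

theorem mem_ell_iff {K : Type*} [Field K] {v : Fin 4 → K} : v ∈ ell K ↔ v 0 = 0 ∧ v 1 = 0 := by
  rw [ell, Submodule.mem_span_pair]
  constructor
  · rintro ⟨a, b, rfl⟩
    simp
  · rintro ⟨h0, h1⟩
    exact ⟨v 2, v 3, by ext m; fin_cases m <;> simp [h0, h1]⟩

theorem finrank_ell_le (K : Type*) [Field K] : Module.finrank K (ell K) ≤ 2 := by
  classical
  have := finrank_span_finset_le_card (R := K)
    ({![0, 0, 1, 0], ![0, 0, 0, 1]} : Finset (Fin 4 → K))
  rw [Finset.coe_pair] at this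
  exact this.trans Finset.card_le_two

theorem tangent_relation {K : Type*} [Field K] [Infinite K] {F : MvPolynomial (Fin 4) K}
    (hhom : F.IsHomogeneous 4) (hline : ∀ i₂ i₃ : ℕ, coeff (expo 0 0 i₂ i₃) F = 0)
    (w : Fin 2 → K) (Q : Fin 4 → K)
    (h : ∀ l : K, eval (![0, 0, w 0, w 1] + l • Q) F = 0) :
    Q 0 * eval w (alphaForm K F) + Q 1 * eval w (betaForm K F) = 0 := by
  rw [← cubicForm_residualCoeff_zero_left]
  have hp : (Polynomial.X : Polynomial K) *
      cubicForm (fun i j k => Polynomial.C (residualCoeff F (Q 0) (Q 1) i j k)) Polynomial.X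
        (Polynomial.C (w 0) + Polynomial.X * Polynomial.C (Q 2))
        (Polynomial.C (w 1) + Polynomial.X * Polynomial.C (Q 3)) = 0 := by
    refine Polynomial.funext fun l => ?_
    have hl : ![0, 0, w 0, w 1] + l • Q = ![l * Q 0, l * Q 1, w 0 + l * Q 2, w 1 + l * Q 3] := by
      ext m
      fin_cases m <;> simp
    have := h l
    rw [hl, eval_mul_eq_cubicForm hhom hline] at this
    rw [← Polynomial.coe_evalRingHom, map_mul, map_cubicForm]
    simpa [mul_comm l] using this
  have := congrArg (Polynomial.evalRingHom 0) ((mul_eq_zero.1 hp).resolve_left Polynomial.X_ne_zero)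
  rw [map_cubicForm] at this
  simpa using this

theorem exists_basePoint_slope {K : Type*} [Field K] [Infinite K] [CharP K 2]
    {F : MvPolynomial (Fin 4) K} (hhom : F.IsHomogeneous 4)
    (hline : ∀ i₂ i₃ : ℕ, coeff (expo 0 0 i₂ i₃) F = 0) {W : Submodule K (Fin 4 → K)}
    (hrank : Module.finrank K W = 2) (hF : ∀ v ∈ W, eval v F = 0) (hW : W ≠ ell K)
    (hsm : ∃ v : Fin 4 → K, v ≠ 0 ∧ v ∈ W ∧ v ∈ ell K ∧ ∃ i : Fin 4, eval v (pderiv i F) ≠ 0) :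
    ∃ (o : Option K) (u : K),
      (eval (basePoint o) (betaForm K F) ≠ 0 ∨ eval (basePoint o) (alphaForm K F) ≠ 0) ∧
      ![0, 0, basePoint o 0, basePoint o 1] ∈ W ∧
      ![eval (basePoint o) (betaForm K F), eval (basePoint o) (alphaForm K F),
        slopeVector o u 0, slopeVector o u 1] ∈ W := by
  obtain ⟨v, hv0, hvW, hvl, i, hi⟩ := hsm
  obtain ⟨e0, e1⟩ := mem_ell_iff.1 hvl
  have hst : v 2 ≠ 0 ∨ v 3 ≠ 0 := by
    by_contra! h
    refine hv0 (funext fun m => ?_)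
    fin_cases m
    exacts [e0, e1, h.1, h.2]
  obtain ⟨o, k, hk, h2, h3⟩ := exists_eq_smul_basePoint hst
  have hv : v = k • ![0, 0, basePoint o 0, basePoint o 1] := by
    ext m
    fin_cases m <;> simp [e0, e1, h2, h3]
  have hPW : ![0, 0, basePoint o 0, basePoint o 1] ∈ W := by
    rwa [hv, W.smul_mem_iff hk] at hvW
  have hAB : eval (basePoint o) (betaForm K F) ≠ 0 ∨ eval (basePoint o) (alphaForm K F) ≠ 0 := by
    by_contra! h
    have hv' : v = ![0, 0, (k • basePoint o) 0, (k • basePoint o) 1] := by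
      rw [hv]
      ext m
      fin_cases m <;> simp
    rw [hv'] at hi
    refine hi (eval_pderiv_eq_zero hhom hline _ ?_ ?_ i)
    · have := h.2
      rw [eval_alphaForm] at this ⊢
      simp [Finset.sum_range_succ] at this ⊢
      linear_combination k ^ 3 * this
    · have := h.1
      rw [eval_betaForm] at this ⊢
      simp [Finset.sum_range_succ] at this ⊢
      linear_combination k ^ 3 * this
  obtain ⟨Q, hQW, hQ⟩ : ∃ Q ∈ W, Q ∉ ell K := by
    by_contra! h
    exact hW (Submodule.eq_of_le_of_finrank_le h ((finrank_ell_le K).trans hrank.ge))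
  rw [mem_ell_iff, not_and_or] at hQ
  have htan := tangent_relation hhom hline (basePoint o) Q fun l =>
    hF _ (W.add_mem hPW (W.smul_mem l hQW))
  set b := eval (basePoint o) (betaForm K F)
  set a := eval (basePoint o) (alphaForm K F)
  have h2 : (2 : K) = 0 := CharTwo.two_eq_zero
  obtain ⟨r, hr0, hr1⟩ : ∃ r, Q 0 = r * b ∧ Q 1 = r * a := by
    rcases hAB with hb | ha
    · refine ⟨Q 0 / b, by field_simp, ?_⟩
      field_simp
      linear_combination htan - Q 0 * a * h2
    · refine ⟨Q 1 / a, ?_, by field_simp⟩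
      field_simp
      linear_combination htan - Q 1 * b * h2
  have hr : r ≠ 0 := by
    rintro rfl
    simp [hr0, hr1] at hQ
  obtain ⟨k', u, hs, ht⟩ := exists_eq_smul_basePoint_add_slopeVector o (r⁻¹ * Q 2) (r⁻¹ * Q 3)
  refine ⟨o, u, hAB, hPW, ?_⟩
  convert W.sub_mem (W.smul_mem r⁻¹ hQW) (W.smul_mem k' hPW) using 1
  ext m
  fin_cases m <;> simp [a, b, hr0, hr1, hs, ht, hr]

theorem eq_span_basePoint_slope {K : Type*} [Field K] {W : Submodule K (Fin 4 → K)}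
    (hrank : Module.finrank K W = 2) {a b s t : K} {o : Option K} (hab : a ≠ 0 ∨ b ≠ 0)
    (hP : ![0, 0, basePoint o 0, basePoint o 1] ∈ W) (hQ : ![a, b, s, t] ∈ W) :
    W = Submodule.span K {![0, 0, basePoint o 0, basePoint o 1], ![a, b, s, t]} := by
  have hli : LinearIndependent K ![![0, 0, basePoint o 0, basePoint o 1], ![a, b, s, t]] := by
    refine LinearIndependent.pair_iff.2 fun x y h => ?_
    have e := fun m => congrFun h m
    have hy : y = 0 := by
      have e0 := e 0
      have e1 := e 1
      simp at e0 e1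
      tauto
    subst hy
    refine ⟨?_, rfl⟩
    have e2 := e 2
    have e3 := e 3
    rcases o with _ | p <;> simp [basePoint] at e2 e3 <;> assumption
  have hfin := finrank_span_eq_card hli
  rw [Fintype.card_fin, Matrix.range_cons, Matrix.range_cons, Matrix.range_empty, Set.union_empty,
    Set.singleton_union] at hfin
  refine (Submodule.eq_of_le_of_finrank_eq ?_ (hfin.trans hrank.symm)).symm
  rw [Submodule.span_le, Set.pair_subset_iff]
  exact ⟨hP, hQ⟩

theorem sum_card_le_totalDegree {K : Type*} [Field K] {R : MvPolynomial (Fin 2) K} (hR : R ≠ 0)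
    (s : Finset (Option K)) (n : Option K → ℕ) (h : ∀ o ∈ s, vanishingForm o ^ n o ∣ R) :
    ∑ o ∈ s, n o ≤ R.totalDegree := by
  have hdvd : ∏ o ∈ s, vanishingForm o ^ n o ∣ R :=
    Finset.prod_dvd_of_isRelPrime (fun o _ o' _ hne => (isRelPrime_vanishingForm hne).pow) h
  have hne : ∀ o : Option K, vanishingForm o ≠ 0 := fun o => (irreducible_vanishingForm o).ne_zero
  have hpow : ∀ (o : Option K) (m : ℕ), (vanishingForm o ^ m).totalDegree = m := by
    intro o m
    induction m with
    | zero => simp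
    | succ m ih =>
      rw [pow_succ, totalDegree_mul_of_isDomain (pow_ne_zero m (hne o)) (hne o), ih,
        totalDegree_vanishingForm]
  have hdeg : (∏ o ∈ s, vanishingForm o ^ n o).totalDegree = ∑ o ∈ s, n o := by
    clear h hdvd
    induction s using Finset.cons_induction with
    | empty => simp
    | cons o s ho ih =>
      rw [Finset.prod_cons, Finset.sum_cons, totalDegree_mul_of_isDomain
        (pow_ne_zero _ (hne o)) (Finset.prod_ne_zero_iff.2 fun o _ => pow_ne_zero _ (hne o)),
        ih, hpow]
  rw [← hdeg]
  exact totalDegree_le_of_dvd_of_isDomain hdvd hR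

theorem lines_card_le {K : Type*} [Field K] [Infinite K] [CharP K 2]
    {F : MvPolynomial (Fin 4) K} (hhom : F.IsHomogeneous 4)
    (hline : ∀ i₂ i₃ : ℕ, coeff (expo 0 0 i₂ i₃) F = 0)
    {gam α β : MvPolynomial (Fin 2) K}
    (hfacα : alphaForm K F = gam * α) (hfacβ : betaForm K F = gam * β)
    (hcop : IsRelPrime α β) (hd : 1 ≤ max α.totalDegree β.totalDegree)
    (hfirst : lineResultant K F α β ≠ 0) (T : Finset (Submodule K (Fin 4 → K)))
    (hT : ∀ W ∈ T, Module.finrank K W = 2 ∧ (∀ v ∈ W, eval v F = 0) ∧ W ≠ ell K ∧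
      ∃ v : Fin 4 → K, v ≠ 0 ∧ v ∈ W ∧ v ∈ ell K ∧ ∃ i : Fin 4, eval v (pderiv i F) ≠ 0) :
    T.card ≤ 3 + 5 * max α.totalDegree β.totalDegree := by
  classical
  have hex : ∀ W : Submodule K (Fin 4 → K), ∃ (o : Option K) (u : K), W ∈ T →
      (eval (basePoint o) (betaForm K F) ≠ 0 ∨ eval (basePoint o) (alphaForm K F) ≠ 0) ∧
      ![0, 0, basePoint o 0, basePoint o 1] ∈ W ∧
      ![eval (basePoint o) (betaForm K F), eval (basePoint o) (alphaForm K F),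
        slopeVector o u 0, slopeVector o u 1] ∈ W := by
    intro W
    by_cases hW : W ∈ T
    · obtain ⟨h1, h2, h3, h4⟩ := hT W hW
      obtain ⟨o, u, h⟩ := exists_basePoint_slope hhom hline h1 h2 h3 h4
      exact ⟨o, u, fun _ => h⟩
    · exact ⟨none, 0, fun h => absurd h hW⟩
  choose o u h using hex
  rw [Finset.card_eq_sum_card_image o]
  refine (sum_card_le_totalDegree hfirst _ _ fun x hx => ?_).trans
    (totalDegree_lineResultant_le F α β)
  have hinj : Set.InjOn u (T.filter fun W => o W = x) := by
    intro W hW W' hW' huu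
    rw [Finset.mem_coe, Finset.mem_filter] at hW hW'
    obtain ⟨hs, hP, hQ⟩ := h W hW.1
    obtain ⟨hs', hP', hQ'⟩ := h W' hW'.1
    rw [eq_span_basePoint_slope (hT W hW.1).1 hs hP hQ,
      eq_span_basePoint_slope (hT W' hW'.1).1 hs' hP' hQ', hW.2, hW'.2, huu]
  rw [← Finset.card_image_of_injOn hinj]
  obtain ⟨W₀, hW₀, rfl⟩ := Finset.mem_image.1 hx
  refine vanishingForm_pow_card_dvd hhom hline hfacα hfacβ hcop hd _ (h W₀ hW₀).1 _ fun r hr l => ?_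
  obtain ⟨W, hW, rfl⟩ := Finset.mem_image.1 hr
  obtain ⟨hWT, hWo⟩ := Finset.mem_filter.1 hW
  obtain ⟨-, hP, hQ⟩ := h W hWT
  rw [← hWo]
  convert (hT W hWT).2.1 _ (W.add_mem hP (W.smul_mem l hQ)) using 3
  ext m
  fin_cases m <;> simp

/-- Proposition 2.12 of the paper.  Let `F` be a quartic form in
characteristic 2 containing the line `ℓ : x₀ = x₁ = 0`, with `α = γ·α̃`, `β = γ·β̃`,
`γ = gcd(α,β)` (encoded by relative primality of `α̃,β̃`), of positive degree
`d = max(deg α̃, deg β̃) ≥ 1`, and of the first kind, i.e. with resultant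
`R(ℓ) = Res_t(t·α̃+β̃, h̃) ≠ 0`.  Then the number of lines on `X = {F = 0}`, distinct
from `ℓ`, meeting `ℓ` at smooth points of `X`, is at most `3 + 5d`. -/
theorem first_kind_line_valency_bound
    (K : Type*) [Field K] [IsAlgClosed K] [CharP K 2]
    (F : MvPolynomial (Fin 4) K) (hF0 : F ≠ 0) (hhom : F.IsHomogeneous 4)
    (hline : ∀ i₂ i₃ : ℕ, coeff (expo 0 0 i₂ i₃) F = 0)
    (gam alphaRed betaRed : MvPolynomial (Fin 2) K)
    (hfacα : alphaForm K F = gam * alphaRed) (hfacβ : betaForm K F = gam * betaRed)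
    (hcop : IsRelPrime alphaRed betaRed)
    (hd : 1 ≤ max alphaRed.totalDegree betaRed.totalDegree)
    (hfirst : lineResultant K F alphaRed betaRed ≠ 0) :
    {W : Submodule K (Fin 4 → K) |
        Module.finrank K W = 2 ∧ (∀ v ∈ W, eval v F = 0) ∧ W ≠ ell K ∧
        ∃ v : Fin 4 → K, v ≠ 0 ∧ v ∈ W ∧ v ∈ ell K ∧
          ∃ i : Fin 4, eval v (pderiv i F) ≠ 0}.Finite ∧
    {W : Submodule K (Fin 4 → K) |
        Module.finrank K W = 2 ∧ (∀ v ∈ W, eval v F = 0) ∧ W ≠ ell K ∧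
        ∃ v : Fin 4 → K, v ≠ 0 ∧ v ∈ W ∧ v ∈ ell K ∧
          ∃ i : Fin 4, eval v (pderiv i F) ≠ 0}.ncard
      ≤ 3 + 5 * max alphaRed.totalDegree betaRed.totalDegree := by
  have key := lines_card_le hhom hline hfacα hfacβ hcop hd hfirst
  set S := {W : Submodule K (Fin 4 → K) |
    Module.finrank K W = 2 ∧ (∀ v ∈ W, eval v F = 0) ∧ W ≠ ell K ∧
    ∃ v : Fin 4 → K, v ≠ 0 ∧ v ∈ W ∧ v ∈ ell K ∧ ∃ i : Fin 4, eval v (pderiv i F) ≠ 0}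
  have hfin : S.Finite := by
    by_contra hS
    obtain ⟨T, hTS, hcard⟩ := Set.Infinite.exists_subset_card_eq hS
      (3 + 5 * max alphaRed.totalDegree betaRed.totalDegree + 1)
    have := key T fun W hW => hTS hW
    omega
  refine ⟨hfin, ?_⟩
  rw [Set.ncard_eq_toFinset_card S hfin]
  exact key _ fun W hW => hfin.mem_toFinset.1 hW
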